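/- arXiv:1004.4609 — 2 statements merged into one kernel-verified Lean document; each statement's English description precedes it below -/
import Mathlib

section
/- Let n ≥ 2, let c, t : Fin n with (c : ℕ) < (t : ℕ), and let h : Bool × Bool → Bool × Bool. Let σ be the permutation of Fin n given by composing, in order, the adjacent transpositions (c, c+1), (c+1, c+2), …, (t−2, t−1), so σ is a product of t − c − 1 adjacent transpositions and σ(c) = t − 1, σ(t) = t. Then the 2-wire gate apply₂ c t h equals the composition (relabel by σ⁻¹) ∘ (apply₂ (t−1) t h) ∘ (relabel by σ): first apply the t − c − 1 adjacent SWAP gates realizing σ, then apply the gate h on the now-adjacent wires t−1 and t, then apply the t − c − 1 adjacent SWAP gates realizing σ⁻¹. In total 2·(t − c − 1) adjacent SWAP gates are used; since each SWAP gate has quantum cost 3, this realizes the non-adjacent gate at an additional quantum cost of 6·(t − c − 1). -/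
/-- The adjacent transposition of `Fin n` swapping positions `i` and `i + 1`
(the identity if `i + 1` is out of range). -/
def adjSwap (n i : ℕ) : Equiv.Perm (Fin n) :=
  if h : i + 1 < n then Equiv.swap ⟨i, Nat.lt_of_succ_lt h⟩ ⟨i + 1, h⟩ else 1

/-- The 2-wire gate on wires `i` and `j` applying `h : Bool × Bool → Bool × Bool`
to the values of wires `i` and `j` and leaving all other wires unchanged. -/
def apply₂ {n : ℕ} (i j : Fin n) (h : Bool × Bool → Bool × Bool)
    (x : Fin n → Bool) : Fin n → Bool :=
  fun k => if k = i then (h (x i, x j)).1 else if k = j then (h (x i, x j)).2 else x k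

theorem adjSwap_prod_aux (n : ℕ) (c : Fin n) (m : ℕ) (hm : (c : ℕ) + m < n) :
    (((((List.range m).map (fun j => adjSwap n ((c : ℕ) + j))).reverse).prod c : Fin n) : ℕ)
        = (c : ℕ) + m ∧
    ∀ k : Fin n, (c : ℕ) + m < (k : ℕ) →
      (((List.range m).map (fun j => adjSwap n ((c : ℕ) + j))).reverse).prod k = k := by
  induction m with
  | zero => simp
  | succ m ih =>
    obtain ⟨h1, h2⟩ := ih (by omega)
    rw [List.range_succ, List.map_append, List.reverse_append]
    simp only [List.map_cons, List.map_nil, List.reverse_cons, List.reverse_nil, List.nil_append,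
      List.prod_append, List.prod_cons, List.prod_nil, mul_one, Equiv.Perm.mul_apply]
    have hlt : (c : ℕ) + m + 1 < n := by omega
    constructor
    · have e : (((List.range m).map (fun j => adjSwap n ((c : ℕ) + j))).reverse).prod c
          = ⟨(c : ℕ) + m, by omega⟩ := Fin.ext h1
      rw [e, adjSwap, dif_pos hlt, Equiv.swap_apply_left]
      rfl
    · intro k hk
      rw [h2 k (by omega), adjSwap, dif_pos hlt]
      apply Equiv.swap_apply_of_ne_of_ne
      · intro e
        have := congrArg Fin.val e
        simp at this
        omega
      · intro e
        have := congrArg Fin.val e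
        simp at this
        omega

/-- Lemma 1 (naive NNC-based decomposition of a single gate): let `σ` be the
permutation obtained by composing, in order, the `t - c - 1` adjacent transpositions
`(c, c+1), (c+1, c+2), …, (t-2, t-1)` (first one applied first).  Then `σ c = t - 1`,
`σ t = t`, and the non-adjacent 2-wire gate on wires `(c, t)` equals
(relabel by `σ⁻¹`) ∘ (the gate on the adjacent wires `(t-1, t)`) ∘ (relabel by `σ`),
where relabeling by a permutation `π` sends a state `x` to `x ∘ π⁻¹`.  In total
`2 * (t - c - 1)` adjacent SWAP gates (each of quantum cost 3, hence additional
quantum cost `6 * (t - c - 1)`) are used. -/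
theorem stmt4 (n : ℕ) (hn : 2 ≤ n) (c t : Fin n) (hct : (c : ℕ) < (t : ℕ))
    (h : Bool × Bool → Bool × Bool) (σ : Equiv.Perm (Fin n))
    (hσ : σ = (((List.range ((t : ℕ) - (c : ℕ) - 1)).map
        (fun j => adjSwap n ((c : ℕ) + j))).reverse).prod) :
    ((σ c : Fin n) : ℕ) = (t : ℕ) - 1 ∧ σ t = t ∧
    ∀ x : Fin n → Bool,
      apply₂ c t h x =
        (apply₂ (⟨(t : ℕ) - 1, Nat.lt_of_le_of_lt (Nat.sub_le _ _) t.isLt⟩ : Fin n) t h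
          (x ∘ ⇑σ⁻¹)) ∘ ⇑σ := by
  obtain ⟨h1, h2⟩ := adjSwap_prod_aux n c ((t : ℕ) - (c : ℕ) - 1) (by omega)
  rw [← hσ] at h1 h2
  have hc : ((σ c : Fin n) : ℕ) = (t : ℕ) - 1 := by omega
  have ht : σ t = t := h2 t (by omega)
  refine ⟨hc, ht, fun x => ?_⟩
  have e : (⟨(t : ℕ) - 1, Nat.lt_of_le_of_lt (Nat.sub_le _ _) t.isLt⟩ : Fin n) = σ c :=
    Fin.ext hc.symm
  rw [e]
  have ht' : σ.symm t = t := by rw [Equiv.symm_apply_eq, ht]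
  have hk : ∀ k, σ k = t ↔ k = t := fun k => by
    conv_lhs => rw [← ht]
    exact σ.injective.eq_iff
  funext k
  simp [apply₂, ht', hk]
end

section
/- Let n ≥ 2 and let G = [g₁, …, g_k] be a list of gates on n wires, where each gᵢ is a 2-wire gate apply₂ cᵢ tᵢ hᵢ with cᵢ ≠ tᵢ (1-wire gates being the special case where hᵢ ignores its second argument and fixes it). Let N = Σᵢ (|cᵢ − tᵢ| − 1) be the total Nearest Neighbor Cost of the circuit. Then there exists a list G' of gates on n wires, each of which is a 2-wire gate apply₂ i j h' with |i − j| = 1 (i.e., every gate in G' is adjacent, so G' has NNC 0), such that the composition of the gates of G' equals the composition g_k ∘ ⋯ ∘ g₁ of the gates of G, and the length of G' is at most k + 2·N, the extra 2·N gates all being adjacent SWAP gates. -/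
/-- A 2-wire gate on `n` wires: a pair of wires together with the Boolean operation
applied to them. -/
abbrev Gate (n : ℕ) := (Fin n × Fin n) × (Bool × Bool → Bool × Bool)

/-- The function computed by a single gate. -/
def runGate {n : ℕ} (g : Gate n) : (Fin n → Bool) → (Fin n → Bool) :=
  apply₂ g.1.1 g.1.2 g.2

/-- The function computed by a circuit (a list of gates, first gate applied first),
i.e. the composition `g_k ∘ ⋯ ∘ g₁`. -/
def runCircuit {n : ℕ} (G : List (Gate n)) (x : Fin n → Bool) : Fin n → Bool :=
  G.foldl (fun s g => runGate g s) x

/-- The Nearest Neighbor Cost of a gate on wires `c` and `t`: `|c - t| - 1`. -/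
def nnc {n : ℕ} (g : Gate n) : ℕ :=
  max (g.1.1 : ℕ) (g.1.2 : ℕ) - min (g.1.1 : ℕ) (g.1.2 : ℕ) - 1

/-- A gate is adjacent iff its two wires differ by exactly 1 (i.e. its NNC is 0). -/
def IsAdjacent {n : ℕ} (g : Gate n) : Prop :=
  max (g.1.1 : ℕ) (g.1.2 : ℕ) = min (g.1.1 : ℕ) (g.1.2 : ℕ) + 1

theorem swap_conj {n : ℕ} (c c' t : Fin n) (h : Bool × Bool → Bool × Bool)
    (h1 : c ≠ c') (h2 : c ≠ t) (h3 : c' ≠ t) (x : Fin n → Bool) :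
    apply₂ c c' Prod.swap (apply₂ c' t h (apply₂ c c' Prod.swap x)) = apply₂ c t h x := by
  funext k
  have h1' := h1.symm
  have h2' := h2.symm
  have h3' := h3.symm
  by_cases k1 : k = c
  · subst k1; simp [apply₂, *]
  by_cases k2 : k = c'
  · subst k2; simp [apply₂, *]
  by_cases k3 : k = t
  · subst k3; simp [apply₂, *]
  simp [apply₂, *]

theorem runCircuit_append {n : ℕ} (A B : List (Gate n)) (x : Fin n → Bool) :
    runCircuit (A ++ B) x = runCircuit B (runCircuit A x) := by
  simp [runCircuit]

theorem exists_step {n : ℕ} (c t : Fin n) (d : ℕ)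
    (hd : max (c : ℕ) (t : ℕ) - min (c : ℕ) (t : ℕ) - 1 = d + 1) :
    ∃ c' : Fin n, c ≠ c' ∧ c ≠ t ∧ c' ≠ t ∧
      max (c : ℕ) (c' : ℕ) = min (c : ℕ) (c' : ℕ) + 1 ∧
      max (c' : ℕ) (t : ℕ) - min (c' : ℕ) (t : ℕ) - 1 = d := by
  have hc := c.isLt
  have ht := t.isLt
  rcases lt_or_ge (c : ℕ) (t : ℕ) with h | h
  · refine ⟨⟨c + 1, by omega⟩, ?_⟩
    simp only [ne_eq, Fin.ext_iff]
    omega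
  · refine ⟨⟨c - 1, by omega⟩, ?_⟩
    simp only [ne_eq, Fin.ext_iff]
    omega

theorem single_gate {n : ℕ} (d : ℕ) : ∀ (c t : Fin n) (h : Bool × Bool → Bool × Bool),
    c ≠ t → nnc ((c, t), h) = d →
    ∃ G' : List (Gate n),
      (∀ g ∈ G', IsAdjacent g) ∧
      (∀ x, runCircuit G' x = apply₂ c t h x) ∧
      G'.length = 1 + 2 * d ∧
      (G'.filter fun g => g.2 ≠ Prod.swap).length ≤ 1 := by
  induction d with
  | zero =>
    intro c t h hct hd
    refine ⟨[((c, t), h)], ?_, fun x => rfl, rfl, List.length_filter_le _ _⟩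
    intro g hg
    rw [List.mem_singleton] at hg
    subst hg
    simp only [nnc, IsAdjacent, ne_eq, Fin.ext_iff] at *
    omega
  | succ d ih =>
    intro c t h hct hd
    obtain ⟨c', h1, h2, h3, h4, h5⟩ := exists_step c t d hd
    obtain ⟨G, a1, a2, a3, a4⟩ := ih c' t h h3 h5
    refine ⟨[((c, c'), Prod.swap)] ++ G ++ [((c, c'), Prod.swap)], ?_, ?_, ?_, ?_⟩
    · intro g hg
      simp only [List.mem_append, List.mem_singleton] at hg
      rcases hg with (rfl | hg) | rfl
      · exact h4
      · exact a1 g hg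
      · exact h4
    · intro x
      rw [runCircuit_append, runCircuit_append, a2]
      exact swap_conj c c' t h h1 h2 h3 x
    · simp only [List.length_append, List.length_singleton, a3]
      omega
    · simpa [List.filter_append] using a4

/-- Every circuit `G` of 2-wire gates with total Nearest Neighbor Cost `N` can be
replaced by an equivalent circuit `G'` all of whose gates are adjacent (so `G'` has
NNC 0), of length at most `length G + 2 * N`, the extra `2 * N` gates all being
adjacent SWAP gates. -/
theorem stmt5 (n : ℕ) (hn : 2 ≤ n) (G : List (Gate n))
    (hG : ∀ g ∈ G, g.1.1 ≠ g.1.2) :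
    ∃ G' : List (Gate n),
      (∀ g ∈ G', IsAdjacent g) ∧
      runCircuit G' = runCircuit G ∧
      G'.length ≤ G.length + 2 * (G.map nnc).sum ∧
      (G'.filter fun g => g.2 ≠ Prod.swap).length ≤ G.length := by
  induction G with
  | nil => exact ⟨[], by simp, rfl, by simp, by simp⟩
  | cons g G ih =>
    obtain ⟨A, a1, a2, a3, a4⟩ := ih fun g' hg' => hG g' (List.mem_cons_of_mem _ hg')
    obtain ⟨B, b1, b2, b3, b4⟩ :=
      single_gate (nnc g) g.1.1 g.1.2 g.2 (hG g List.mem_cons_self) rfl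
    refine ⟨B ++ A, ?_, ?_, ?_, ?_⟩
    · intro g' hg'
      rcases List.mem_append.1 hg' with h | h
      · exact b1 g' h
      · exact a1 g' h
    · funext x
      rw [runCircuit_append, b2, a2]
      rfl
    · simp only [List.length_append, List.length_cons, List.map_cons, List.sum_cons]
      omega
    · rw [List.filter_append, List.length_append, List.length_cons]
      omega
end
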